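/- arXiv:1304.7274 — 2 statements merged into one kernel-verified Lean document; each statement's English description precedes it below -/
import Mathlib

section
/- Let $m, n, q$ be positive integers and let $1 \le l \le n$. For $k \ge 0$ let $S_{m,n,q,k}$ denote the set of staircase $m \times n$ matrices $(p_{i,j})$ of non-negative integers such that (i) either every row sum $\sum_{j} p_{i,j}$ is strictly smaller than $q$ or every column sum $\sum_{i} p_{i,j}$ is strictly smaller than $q$, and (ii) at least $k$ of the column sums $\sum_{i} p_{i,j}$ are at least $q$. Then $\sum_{k=l}^{n} \binom{k}{l}\, |S_{m,n,q,k} \setminus S_{m,n,q,k+1}| = \binom{n}{l} \sum_{j=0}^{m} (-1)^{m-j}\binom{m}{j}\binom{jq - lq + n - 1}{m+n-1}$. -/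
/-- An `m × n` matrix of non-negative integers is staircase if whenever
`p i j > 0`, `i' < i` and `j < j'`, then `p i' j' = 0`. -/
def IsStaircase {m n : ℕ} (p : Fin m → Fin n → ℕ) : Prop :=
  ∀ i i' : Fin m, ∀ j j' : Fin n, 0 < p i j → i' < i → j < j' → p i' j' = 0

/-- Binomial coefficient of an integer `t` over a natural `b`, with the
convention that it is `0` whenever `t < b` (in particular whenever `t < 0`). -/
def ichoose (t : ℤ) (b : ℕ) : ℤ :=
  if t < (b : ℤ) then 0 else ((t.toNat.choose b : ℕ) : ℤ)

/-- The set `S_{m,n,q,k}` of staircase matrices such that either all row sums or all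
column sums are `< q`, and at least `k` of the column sums are `≥ q`. -/
def S (m n q k : ℕ) : Set (Fin m → Fin n → ℕ) :=
  {p | IsStaircase p ∧
    ((∀ i : Fin m, ∑ j, p i j < q) ∨ (∀ j : Fin n, ∑ i, p i j < q)) ∧
    k ≤ (Finset.univ.filter (fun j : Fin n => q ≤ ∑ i, p i j)).card}

open Finset in
/-- The number of weak compositions of `N` indexed by a type of cardinality `d + 1`. -/
lemma card_piAntidiag_univ {ι : Type*} [Fintype ι] [DecidableEq ι] {d : ℕ}
    (hd : Fintype.card ι = d + 1) (N : ℕ) :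
    (piAntidiag (univ : Finset ι) N).card = (N + d).choose d := by
  have h1 : (piAntidiag (univ : Finset ι) N).card = Nat.card {P : ι → ℕ // ∑ i, P i = N} := by
    rw [Nat.subtype_card]
    simp
  rw [h1, ← Nat.card_congr (Sym.equivNatSumOfFintype ι N), Nat.card_eq_fintype_card,
    Sym.card_sym_eq_choose, hd,
    show d + 1 + N - 1 = N + d by omega, ← Nat.choose_symm_add]

open Finset in
/-- The number of weak compositions of `N` whose parts indexed by `U` are at least `q`. -/
lemma card_piAntidiag_filter_le {ι : Type*} [Fintype ι] [DecidableEq ι] {d : ℕ}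
    (hd : Fintype.card ι = d + 1) (N q : ℕ) (U : Finset ι) :
    (((piAntidiag (univ : Finset ι) N).filter (fun f => ∀ i ∈ U, q ≤ f i)).card : ℤ)
      = ichoose ((N : ℤ) - U.card * q + d) d := by
  have hsum : ∑ i, (if i ∈ U then q else 0) = U.card * q := by simp
  unfold ichoose
  split_ifs with h
  · rw [Nat.cast_eq_zero, card_eq_zero, filter_eq_empty_iff]
    intro f hf hU
    have hf : ∑ i, f i = N := by simpa using hf
    have : ∑ i, (if i ∈ U then q else 0) ≤ ∑ i, f i :=
      sum_le_sum fun i _ => by split_ifs with hi <;> simp [hU, hi]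
    rw [hsum, hf] at this
    zify at this
    linarith
  · obtain ⟨M, hM⟩ : ∃ M, N = M + U.card * q := ⟨N - U.card * q, by zify at *; omega⟩
    have ht : ((N : ℤ) - U.card * q + d).toNat = M + d := by subst hM; push_cast; omega
    rw [ht, ← card_piAntidiag_univ hd M]
    norm_cast
    refine card_nbij' (fun f i => f i - if i ∈ U then q else 0)
      (fun f i => f i + if i ∈ U then q else 0) ?_ ?_ ?_ ?_
    · intro f hf
      simp only [coe_filter, mem_piAntidiag, mem_univ, implies_true, and_true,
        Set.mem_ofPred_eq] at hf
      simp only [mem_coe, mem_piAntidiag, mem_univ, implies_true, and_true]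
      have : ∑ i, (f i - if i ∈ U then q else 0) + ∑ i, (if i ∈ U then q else 0) = ∑ i, f i := by
        rw [← sum_add_distrib]
        refine sum_congr rfl fun i _ => ?_
        split_ifs with hi
        · have := hf.2 i hi
          omega
        · simp
      have hN : ∑ i, f i = N := hf.1
      rw [hsum] at this
      change ∑ i, (f i - if i ∈ U then q else 0) = M
      omega
    · intro f hf
      simp only [mem_coe, mem_piAntidiag, mem_univ, implies_true, and_true] at hf
      simp only [coe_filter, mem_piAntidiag, mem_univ, implies_true, and_true,
        Set.mem_ofPred_eq, sum_add_distrib, hsum]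
      have hf : ∑ i, f i = M := hf
      exact ⟨by omega, fun i hi => by simp [hi]⟩
    · intro f hf
      simp only [coe_filter, Set.mem_ofPred_eq] at hf
      funext i
      by_cases hi : i ∈ U
      · simp [hi, hf.2 i hi]
      · simp [hi]
    · intro f _
      funext i
      simp

open Finset in
/-- Inclusion–exclusion for the condition that no `f i` with `i ∈ A` reaches `q`. -/
lemma ite_forall_lt_eq_sum_powerset {ι : Type*} [DecidableEq ι] (A : Finset ι) (f : ι → ℕ)
    (q : ℕ) :
    (if ∀ i ∈ A, f i < q then (1 : ℤ) else 0)
      = ∑ U ∈ A.powerset, (-1) ^ U.card * (if ∀ i ∈ U, q ≤ f i then 1 else 0) := by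
  have h1 : (if ∀ i ∈ A, f i < q then (1 : ℤ) else 0)
      = ∏ i ∈ A, (-(if q ≤ f i then (1 : ℤ) else 0) + 1) := by
    rw [← prod_const_one (s := A), ← prod_ite_zero]
    refine prod_congr rfl fun i _ => ?_
    by_cases h : q ≤ f i
    · simp [h, not_lt.mpr h]
    · simp [h, not_le.mp h]
  rw [h1, prod_add]
  refine sum_congr rfl fun U _ => ?_
  rw [prod_const_one, mul_one, prod_neg, prod_ite_zero, prod_const_one]

open Finset in
/-- For a staircase matrix, the sum over an initial block is the minimum of the partial
sums of row sums and of column sums. -/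
lemma IsStaircase.sum_block {m n : ℕ} {p : Fin m → Fin n → ℕ} (hp : IsStaircase p)
    {A : Finset (Fin m)} {B : Finset (Fin n)} (hA : IsLowerSet (A : Set (Fin m)))
    (hB : IsLowerSet (B : Set (Fin n))) :
    ∑ i ∈ A, ∑ j ∈ B, p i j = min (∑ i ∈ A, ∑ j, p i j) (∑ j ∈ B, ∑ i, p i j) := by
  have hR : ∑ i ∈ A, ∑ j, p i j = ∑ i ∈ A, ∑ j ∈ B, p i j + ∑ i ∈ A, ∑ j ∈ Bᶜ, p i j := by
    rw [← sum_add_distrib]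
    exact sum_congr rfl fun i _ => (sum_add_sum_compl B _).symm
  have hC : ∑ j ∈ B, ∑ i, p i j = ∑ i ∈ A, ∑ j ∈ B, p i j + ∑ i ∈ Aᶜ, ∑ j ∈ B, p i j := by
    rw [sum_comm, sum_add_sum_compl]
  have h : ∑ i ∈ A, ∑ j ∈ Bᶜ, p i j = 0 ∨ ∑ i ∈ Aᶜ, ∑ j ∈ B, p i j = 0 := by
    by_contra! hne
    obtain ⟨i', hi', h1⟩ := exists_ne_zero_of_sum_ne_zero hne.1
    obtain ⟨j', hj', h1⟩ := exists_ne_zero_of_sum_ne_zero h1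
    obtain ⟨i, hi, h2⟩ := exists_ne_zero_of_sum_ne_zero hne.2
    obtain ⟨j, hj, h2⟩ := exists_ne_zero_of_sum_ne_zero h2
    rw [mem_compl] at hi hj'
    refine h1 (hp i i' j j' (Nat.pos_of_ne_zero h2) ?_ ?_)
    · exact not_le.mp fun hle => hi (hA hle hi')
    · exact not_le.mp fun hle => hj' (hB hle hj)
  omega

open Finset in
/-- A staircase matrix is determined by its row sums and column sums. -/
lemma IsStaircase.eq_of_sums {m n : ℕ} {p p' : Fin m → Fin n → ℕ} (hp : IsStaircase p)
    (hp' : IsStaircase p') (hr : ∀ i, ∑ j, p i j = ∑ j, p' i j)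
    (hc : ∀ j, ∑ i, p i j = ∑ i, p' i j) : p = p' := by
  have key : ∀ (A : Finset (Fin m)) (B : Finset (Fin n)), IsLowerSet (A : Set (Fin m)) →
      IsLowerSet (B : Set (Fin n)) → ∑ i ∈ A, ∑ j ∈ B, p i j = ∑ i ∈ A, ∑ j ∈ B, p' i j := by
    intro A B hA hB
    rw [hp.sum_block hA hB, hp'.sum_block hA hB]
    simp only [hr, hc]
  have hIic : ∀ {k : ℕ} (a : Fin k), IsLowerSet ((Iic a : Finset (Fin k)) : Set (Fin k)) :=
    fun a => by rw [coe_Iic]; exact isLowerSet_Iic a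
  have hIio : ∀ {k : ℕ} (a : Fin k), IsLowerSet ((Iio a : Finset (Fin k)) : Set (Fin k)) :=
    fun a => by rw [coe_Iio]; exact isLowerSet_Iio a
  funext i j
  have h1 := key _ _ (hIic i) (hIic j)
  have h2 := key _ _ (hIic i) (hIio j)
  have h3 := key _ _ (hIio i) (hIic j)
  have h4 := key _ _ (hIio i) (hIio j)
  simp only [← Iio_insert, sum_insert (notMem_Iio_self), sum_add_distrib] at h1 h2 h3 h4
  omega

open Finset in
/-- The intervals `[C j, C (j + 1))` cut out of `[a, b)` pieces of total length `b - a`. -/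
lemma sum_interval_overlap (C : ℕ → ℕ) (hC : Monotone C) (h0 : C 0 = 0) {a b : ℕ} (hab : a ≤ b)
    (k : ℕ) : ∑ j ∈ range k, (min b (C (j + 1)) - max a (C j)) = min b (C k) - min a (C k) := by
  induction k with
  | zero => simp [h0]
  | succ k ih =>
    have := hC (Nat.le_succ k)
    rw [sum_range_succ, ih]
    simp only [Nat.succ_eq_add_one] at this
    omega

open Finset in
lemma exists_partial_sums {n : ℕ} (c : Fin n → ℕ) :
    ∃ C : ℕ → ℕ, Monotone C ∧ C 0 = 0 ∧ C n = ∑ j, c j ∧ ∀ j : Fin n, C (j + 1) = C j + c j := by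
  refine ⟨fun k => ∑ j ∈ range k, if h : j < n then c ⟨j, h⟩ else 0, ?_, by simp, ?_, ?_⟩
  · exact fun a b hab => sum_le_sum_of_subset (range_subset_range.mpr hab)
  · simp only [sum_range, Fin.is_lt, dif_pos]
  · intro j
    simp [sum_range_succ]

open Finset in
/-- Every pair of vectors with equal totals arises as row and column sums of a staircase matrix. -/
lemma exists_isStaircase {m n : ℕ} (r : Fin m → ℕ) (c : Fin n → ℕ) (h : ∑ i, r i = ∑ j, c j) :
    ∃ p : Fin m → Fin n → ℕ, IsStaircase p ∧ (∀ i, ∑ j, p i j = r i) ∧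
      ∀ j, ∑ i, p i j = c j := by
  obtain ⟨R, hR, hR0, hRm, hRs⟩ := exists_partial_sums r
  obtain ⟨C, hC, hC0, hCn, hCs⟩ := exists_partial_sums c
  refine ⟨fun i j => min (R (i + 1)) (C (j + 1)) - max (R i) (C j), ?_, ?_, ?_⟩
  · intro i i' j j' hpos hi hj
    have h1 : R (i' + 1) ≤ R i := hR hi
    have h2 : C (j + 1) ≤ C j' := hC hj
    dsimp only at hpos ⊢
    omega
  · intro i
    rw [← sum_range (fun j => min (R (i + 1)) (C (j + 1)) - max (R i) (C j)),
      sum_interval_overlap C hC hC0 (hR (Nat.le_succ i)), Nat.succ_eq_add_one]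
    have h1 : R (i + 1) ≤ R m := hR i.is_lt
    have := hRs i
    omega
  · intro j
    have hs := sum_interval_overlap R hR hR0 (hC (Nat.le_succ j)) m
    rw [sum_range] at hs
    simp only [min_comm (R _), max_comm (R _)]
    rw [hs]
    have h1 : C (j + 1) ≤ C n := hC j.is_lt
    have := hCs j
    simp only [Nat.succ_eq_add_one]
    omega

open Finset in
/-- Weak compositions of `m * (q - 1)` with `m + n` parts, the first `m` of which are below `q`. -/
def boundedCompositions (m n q : ℕ) : Finset (Fin m ⊕ Fin n → ℕ) :=
  (piAntidiag univ (m * (q - 1))).filter (fun f => ∀ i, f (Sum.inl i) < q)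

open Finset in
/-- Staircase matrices correspond to pairs of complemented row sums and column sums. -/
lemma ncard_S_diff {m n q k : ℕ} (hk : 1 ≤ k) :
    (S m n q k \ S m n q (k + 1)).ncard
      = ((boundedCompositions m n q).filter
          (fun f => (univ.filter (fun j => q ≤ f (Sum.inr j))).card = k)).card := by
  have hmem : ∀ p, p ∈ S m n q k \ S m n q (k + 1) ↔ IsStaircase p ∧ (∀ i, ∑ j, p i j < q) ∧
      (univ.filter (fun j : Fin n => q ≤ ∑ i, p i j)).card = k := by
    intro p
    simp only [S, Set.mem_sdiff, Set.mem_ofPred_eq]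
    constructor
    · rintro ⟨⟨h1, h2, h3⟩, h4⟩
      have hcard : (univ.filter (fun j : Fin n => q ≤ ∑ i, p i j)).card = k := by
        by_contra hne
        exact h4 ⟨h1, h2, by omega⟩
      refine ⟨h1, h2.resolve_right fun h => ?_, hcard⟩
      rw [filter_false_of_mem fun j _ => not_le.mpr (h j), card_empty] at hcard
      omega
    · rintro ⟨h1, h2, h3⟩
      exact ⟨⟨h1, Or.inl h2, h3.ge⟩, fun h => by omega⟩
  have hcompl : ∀ r : Fin m → ℕ, (∀ i, r i < q) →
      ∑ i, (q - 1 - r i) + ∑ i, r i = m * (q - 1) := by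
    intro r hr
    rw [← sum_add_distrib, sum_congr rfl fun i _ => Nat.sub_add_cancel (Nat.le_sub_one_of_lt (hr i))]
    simp
  rw [← Set.ncard_coe_finset]
  refine Set.BijOn.ncard_eq (f := fun p => Sum.elim (fun i => q - 1 - ∑ j, p i j)
    (fun j => ∑ i, p i j)) ⟨?_, ?_, ?_⟩
  · intro p hp
    obtain ⟨-, h2, h3⟩ := (hmem p).mp hp
    simp only [boundedCompositions, coe_filter, mem_filter, mem_piAntidiag, Fintype.sum_sum_type,
      Sum.elim_inl, Sum.elim_inr, mem_univ, implies_true, and_true, Set.mem_ofPred_eq]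
    refine ⟨⟨?_, fun i => ?_⟩, h3⟩
    · rw [sum_comm (s := univ (α := Fin n)), hcompl _ h2]
    · have := h2 i
      omega
  · intro p hp p' hp' heq
    obtain ⟨h1, h2, -⟩ := (hmem p).mp hp
    obtain ⟨h1', h2', -⟩ := (hmem p').mp hp'
    refine h1.eq_of_sums h1' (fun i => ?_) fun j => congrFun heq (Sum.inr j)
    have h3 : q - 1 - ∑ j, p i j = q - 1 - ∑ j, p' i j := congrFun heq (Sum.inl i)
    have := h2 i
    have := h2' i
    omega
  · intro f hf
    simp only [boundedCompositions, coe_filter, mem_filter, mem_piAntidiag, Fintype.sum_sum_type,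
      mem_univ, implies_true, and_true, Set.mem_ofPred_eq] at hf
    obtain ⟨⟨h1, h2⟩, h3⟩ := hf
    have hf := hcompl _ h2
    obtain ⟨p, hp, hr, hc⟩ := exists_isStaircase (fun i => q - 1 - f (Sum.inl i))
      (fun j => f (Sum.inr j)) (by omega)
    refine ⟨p, (hmem p).mpr ⟨hp, fun i => ?_, by simpa only [hc] using h3⟩, ?_⟩
    · have := h2 i
      rw [hr]
      omega
    · funext x
      rcases x with i | j
      · have := h2 i
        simp only [Sum.elim_inl, hr]
        omega
      · simp only [Sum.elim_inr, hc]

open Finset in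
/-- The bounded compositions whose last parts indexed by `T` are at least `q`. -/
lemma card_boundedCompositions_filter {m n q : ℕ} (hm : 0 < m) (hq : 0 < q)
    (T : Finset (Fin n)) :
    (((boundedCompositions m n q).filter (fun f => ∀ j ∈ T, q ≤ f (Sum.inr j))).card : ℤ)
      = ∑ j ∈ range (m + 1), (-1 : ℤ) ^ (m - j) * (m.choose j : ℤ) *
          ichoose ((j : ℤ) * q - (T.card : ℤ) * q + n - 1) (m + n - 1) := by
  have hd : Fintype.card (Fin m ⊕ Fin n) = (m + n - 1) + 1 := by
    simp only [Fintype.card_sum, Fintype.card_fin]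
    omega
  have hU : ∀ U : Finset (Fin m),
      (∑ f ∈ piAntidiag (univ : Finset (Fin m ⊕ Fin n)) (m * (q - 1)),
        if (∀ i ∈ U, q ≤ f (Sum.inl i)) ∧ ∀ j ∈ T, q ≤ f (Sum.inr j) then (1 : ℤ) else 0)
      = ichoose (((m : ℤ) - U.card) * q - (T.card : ℤ) * q + n - 1) (m + n - 1) := by
    intro U
    have := card_piAntidiag_filter_le hd (m * (q - 1)) q (U.disjSum T)
    rw [card_filter, card_disjSum] at this
    push_cast [Nat.cast_sub (show 1 ≤ q from hq), Nat.cast_sub (show 1 ≤ m + n by omega)] at this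
    rw [show ((m : ℤ) - U.card) * q - (T.card : ℤ) * q + n - 1
      = m * (q - 1) - (U.card + T.card) * q + (m + n - 1) by ring, ← this]
    refine sum_congr rfl fun f _ => if_congr ?_ rfl rfl
    simp [Sum.forall]
  calc _ = ∑ f ∈ piAntidiag (univ : Finset (Fin m ⊕ Fin n)) (m * (q - 1)),
        ∑ U ∈ (univ : Finset (Fin m)).powerset, (-1 : ℤ) ^ U.card *
          if (∀ i ∈ U, q ≤ f (Sum.inl i)) ∧ ∀ j ∈ T, q ≤ f (Sum.inr j) then (1 : ℤ) else 0 := by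
        rw [boundedCompositions, filter_filter, card_filter]
        push_cast
        refine sum_congr rfl fun f _ => ?_
        have := ite_forall_lt_eq_sum_powerset (univ : Finset (Fin m)) (fun i => f (Sum.inl i)) q
        by_cases hT : ∀ j ∈ T, q ≤ f (Sum.inr j)
        · simp only [eq_true hT, and_true]
          simpa using this
        · simp [hT]
    _ = ∑ U ∈ (univ : Finset (Fin m)).powerset, (-1 : ℤ) ^ U.card *
          ichoose (((m : ℤ) - U.card) * q - (T.card : ℤ) * q + n - 1) (m + n - 1) := by
        rw [sum_comm]
        refine sum_congr rfl fun U _ => ?_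
        rw [← mul_sum, hU]
    _ = _ := by
        rw [sum_powerset_apply_card (fun k => (-1 : ℤ) ^ k *
          ichoose (((m : ℤ) - k) * q - (T.card : ℤ) * q + n - 1) (m + n - 1)), card_fin,
          ← sum_range_reflect]
        refine sum_congr rfl fun j hj => ?_
        have hj : j ≤ m := Nat.lt_succ_iff.mp (mem_range.mp hj)
        rw [show m + 1 - 1 - j = m - j by omega, Nat.choose_symm hj, Nat.cast_sub hj, nsmul_eq_mul,
          sub_sub_cancel]
        ring

theorem stmt_7 (m n q l : ℕ) (hm : 0 < m) (hn : 0 < n) (hq : 0 < q)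
    (hl : 1 ≤ l) (hln : l ≤ n) :
    (∑ k ∈ Finset.Icc l n, (k.choose l : ℤ) * ((S m n q k \ S m n q (k + 1)).ncard : ℤ))
      = (n.choose l : ℤ) * ∑ j ∈ Finset.range (m + 1),
          (-1 : ℤ) ^ (m - j) * (m.choose j : ℤ) *
            ichoose ((j : ℤ) * q - (l : ℤ) * q + n - 1) (m + n - 1) := by
  let big : (Fin m ⊕ Fin n → ℕ) → Finset (Fin n) :=
    fun f => Finset.univ.filter (fun j => q ≤ f (Sum.inr j))
  open Finset in
  calc _ = ∑ k ∈ Icc l n, ∑ f ∈ boundedCompositions m n q,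
        if (big f).card = k then ((big f).card.choose l : ℤ) else 0 := by
        refine sum_congr rfl fun k hk => ?_
        rw [ncard_S_diff (hl.trans (mem_Icc.mp hk).1), card_filter, Nat.cast_sum, mul_sum]
        refine sum_congr rfl fun f _ => ?_
        by_cases h : (big f).card = k
        · simp [big, ← h]
        · simp [big, h]
    _ = ∑ f ∈ boundedCompositions m n q, ((big f).card.choose l : ℤ) := by
        rw [sum_comm]
        refine sum_congr rfl fun f _ => ?_
        rw [sum_ite_eq]
        have hle : (big f).card ≤ n := by simpa using card_le_univ (big f)
        split_ifs with h
        · rfl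
        · rw [Nat.choose_eq_zero_of_lt, Nat.cast_zero]
          rw [mem_Icc] at h
          omega
    _ = ∑ f ∈ boundedCompositions m n q, ∑ T ∈ powersetCard l (univ : Finset (Fin n)),
          if ∀ j ∈ T, q ≤ f (Sum.inr j) then (1 : ℤ) else 0 := by
        refine sum_congr rfl fun f _ => ?_
        rw [← card_powersetCard, sum_boole]
        congr 2
        ext T
        simp [big, mem_powersetCard, subset_iff, and_comm]
    _ = ∑ T ∈ powersetCard l (univ : Finset (Fin n)), ∑ j ∈ range (m + 1),
          (-1 : ℤ) ^ (m - j) * (m.choose j : ℤ) *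
            ichoose ((j : ℤ) * q - (l : ℤ) * q + n - 1) (m + n - 1) := by
        rw [sum_comm]
        refine sum_congr rfl fun T hT => ?_
        rw [← (mem_powersetCard.mp hT).2, ← card_boundedCompositions_filter hm hq, card_filter]
        push_cast
        rfl
    _ = _ := by
        rw [sum_const, card_powersetCard, card_fin, nsmul_eq_mul]
end

section
/- Let $k$ be a field, let $m, n, q$ be positive integers, and let $k[X]$ be the polynomial ring in the $mn$ variables $x_{i,j}$ ($1 \le i \le m$, $1 \le j \le n$). Let $I_2(X)$ be the ideal generated by the $2 \times 2$ minors $x_{i,j} x_{i',j'} - x_{i,j'} x_{i',j}$ for $i < i'$ and $j < j'$. Then the dimension of the $k$-vector space $k[X]/\left(I_2(X) + (x_{1,1}^q, \dots, x_{m,n}^q)\right)$ equals the number of staircase $m \times n$ matrices $(p_{i,j})$ of non-negative integers such that either $\sum_{j} p_{i,j} < q$ for all $i = 1,\dots,m$, or $\sum_{i} p_{i,j} < q$ for all $j = 1,\dots,n$. -/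
open MvPolynomial

open Finset in
/-- A staircase matrix is determined by its row sums and its column sums. -/
theorem IsStaircase.eq_of_sum_eq {m n : ℕ} {p p' : Fin m → Fin n → ℕ}
    (hp : IsStaircase p) (hp' : IsStaircase p') (hrow : ∀ i, ∑ j, p i j = ∑ j, p' i j)
    (hcol : ∀ j, ∑ i, p i j = ∑ i, p' i j) : p = p' := by
  have key : ∀ {r r' : Fin m → Fin n → ℕ}, IsStaircase r →
      (∀ i, ∑ j, r i j = ∑ j, r' i j) → (∀ j, ∑ i, r i j = ∑ i, r' i j) →
      ∀ i j, (∀ j' < j, r i j' = r' i j') → (∀ i' < i, r i' j = r' i' j) →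
        ¬ r i j < r' i j := by
    intro r r' hr hrow hcol i j hleft habove hlt
    obtain ⟨j', hj, hj'⟩ : ∃ j', j < j' ∧ 0 < r i j' := by
      by_contra! h
      refine (Finset.sum_lt_sum (s := univ) (f := r i) (g := r' i) (fun c _ => ?_)
        ⟨j, mem_univ j, hlt⟩).ne (hrow i)
      rcases lt_trichotomy c j with hc | rfl | hc
      · exact (hleft c hc).le
      · exact hlt.le
      · exact (h c hc).trans (Nat.zero_le _)
    obtain ⟨i', hi, hi'⟩ : ∃ i', i < i' ∧ 0 < r i' j := by
      by_contra! h
      refine (Finset.sum_lt_sum (s := univ) (f := fun c => r c j) (g := fun c => r' c j)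
        (fun c _ => ?_) ⟨i, mem_univ i, hlt⟩).ne (hcol j)
      rcases lt_trichotomy c i with hc | rfl | hc
      · exact (habove c hc).le
      · exact hlt.le
      · exact (h c hc).trans (Nat.zero_le _)
    exact hj'.ne' (hr i' i j j' hi' hi hj)
  have heq : ∀ i j, p i j = p' i j := by
    intro i
    induction i using WellFoundedLT.induction with
    | ind i ihi =>
      intro j
      induction j using WellFoundedLT.induction with
      | ind j ihj =>
        refine le_antisymm (not_lt.mp ?_) (not_lt.mp ?_)
        · exact key hp' (fun i => (hrow i).symm) (fun j => (hcol j).symm) i j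
            (fun c hc => (ihj c hc).symm) (fun c hc => (ihi c hc j).symm)
        · exact key hp hrow hcol i j ihj (fun c hc => ihi c hc j)
  exact funext fun i => funext fun j => heq i j

/-- The pair of the vector of row sums and the vector of column sums of a matrix. -/
def margins {m n : ℕ} : (Fin m × Fin n →₀ ℕ) →+ (Fin m → ℕ) × (Fin n → ℕ) where
  toFun p := (fun i => ∑ j, p (i, j), fun j => ∑ i, p (i, j))
  map_zero' := by ext <;> simp
  map_add' p p' := by ext <;> simp [Finset.sum_add_distrib]

theorem margins_single {m n : ℕ} (i : Fin m) (j : Fin n) (q : ℕ) :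
    margins (Finsupp.single (i, j) q) = (Pi.single i q, Pi.single j q) := by
  ext c
  · by_cases h : i = c
    · subst h; simp [margins, Finsupp.single_apply]
    · simp [margins, Finsupp.single_apply, h, Ne.symm h]
  · by_cases h : j = c
    · subst h; simp [margins, Finsupp.single_apply]
    · simp [margins, Finsupp.single_apply, h, Ne.symm h]

/-- Moving one unit from each of the positions `(i, j)`, `(i', j')` to each of
`(i, j')`, `(i', j)` preserves the row sums and the column sums. -/
theorem margins_exchange {m n : ℕ} (r : Fin m × Fin n →₀ ℕ) (i i' : Fin m) (j j' : Fin n) :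
    margins (r + (Finsupp.single (i, j') 1 + Finsupp.single (i', j) 1)) =
      margins (r + (Finsupp.single (i, j) 1 + Finsupp.single (i', j') 1)) := by
  simp [margins_single, add_comm]

theorem exists_eq_add_single_add_single {σ : Type*} {p : σ →₀ ℕ} {a b : σ} (hab : a ≠ b)
    (ha : 0 < p a) (hb : 0 < p b) :
    ∃ r, p = r + (Finsupp.single a 1 + Finsupp.single b 1) := by
  classical
  refine ⟨p - (Finsupp.single a 1 + Finsupp.single b 1), (tsub_add_cancel_of_le ?_).symm⟩
  intro c
  simp only [Finsupp.add_apply, Finsupp.single_apply]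
  split_ifs <;> grind

/-- All row sums, or all column sums, are below `q`. -/
def HasSmallMargin {m n : ℕ} (q : ℕ) (s : (Fin m → ℕ) × (Fin n → ℕ)) : Prop :=
  (∀ i, s.1 i < q) ∨ ∀ j, s.2 j < q

section ideal

variable {m n q : ℕ} {k : Type*} [Field k]

/-- The ideal of `q`-th powers of the variables. -/
noncomputable def powersIdeal (m n q : ℕ) (k : Type*) [Field k] :
    Ideal (MvPolynomial (Fin m × Fin n) k) :=
  Ideal.span {f | ∃ ij : Fin m × Fin n, f = X ij ^ q}

/-- The ideal of `2 × 2` minors of the generic `m × n` matrix. -/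
noncomputable def minorsIdeal (m n : ℕ) (k : Type*) [Field k] :
    Ideal (MvPolynomial (Fin m × Fin n) k) :=
  Ideal.span {f | ∃ (i i' : Fin m) (j j' : Fin n), i < i' ∧ j < j' ∧
      f = X (i, j) * X (i', j') - X (i, j') * X (i', j)}

theorem minor_mem_minorsIdeal (i i' : Fin m) (j j' : Fin n) :
    X (i, j) * X (i', j') - X (i, j') * X (i', j) ∈ minorsIdeal m n k := by
  have key : ∀ (i i' : Fin m) (j j' : Fin n), i < i' →
      X (i, j) * X (i', j') - X (i, j') * X (i', j) ∈ minorsIdeal m n k := by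
    intro i i' j j' hi
    rcases lt_trichotomy j j' with hj | rfl | hj
    · exact Ideal.subset_span ⟨i, i', j, j', hi, hj, rfl⟩
    · simp
    · rw [← neg_sub]
      exact neg_mem (Ideal.subset_span ⟨i, i', j', j, hi, hj, rfl⟩)
  rcases lt_trichotomy i i' with hi | rfl | hi
  · exact key i i' j j' hi
  · simp [mul_comm]
  · convert key i' i j' j hi using 1
    ring

theorem monomial_exchange_sub_mem (r : Fin m × Fin n →₀ ℕ) (i i' : Fin m) (j j' : Fin n) :
    monomial (r + (Finsupp.single (i, j) 1 + Finsupp.single (i', j') 1)) 1 -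
      monomial (r + (Finsupp.single (i, j') 1 + Finsupp.single (i', j) 1)) 1 ∈
        minorsIdeal m n k := by
  convert (minorsIdeal m n k).mul_mem_left (monomial r 1) (minor_mem_minorsIdeal i i' j j')
    using 1
  simp [X, mul_sub, monomial_mul]

/-- Every monomial is congruent, modulo the `2 × 2` minors, to a staircase monomial with the same
row sums and column sums. -/
theorem exists_isStaircase_monomial_sub_mem (p : Fin m × Fin n →₀ ℕ) :
    ∃ p' : Fin m × Fin n →₀ ℕ, IsStaircase (fun i j => p' (i, j)) ∧ margins p' = margins p ∧
      monomial p 1 - monomial p' 1 ∈ minorsIdeal m n k := by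
  let w : (Fin m × Fin n →₀ ℕ) →+ ℕ :=
    { toFun := fun p => p.sum fun x c => c * (x.1 * (n - x.2))
      map_zero' := by simp
      map_add' := fun p p' => Finsupp.sum_add_index' (by simp) (by intros; ring) }
  have w_single : ∀ i j, w (Finsupp.single (i, j) 1) = i * (n - j) := by
    intro i j
    change Finsupp.sum _ (fun (x : Fin m × Fin n) c => c * ((x.1 : ℕ) * (n - x.2))) = _
    rw [Finsupp.sum_single_index (zero_mul _), one_mul]
  induction hN : w p using Nat.strong_induction_on generalizing p with
  | _ N ih =>
    subst hN
    by_cases hp : IsStaircase fun i j => p (i, j)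
    · exact ⟨p, hp, rfl, by simp⟩
    · simp only [IsStaircase, not_forall] at hp
      obtain ⟨i, i', j, j', hpos, hi, hj, hpos'⟩ := hp
      obtain ⟨r, rfl⟩ := exists_eq_add_single_add_single (a := (i, j)) (b := (i', j'))
        (by simp [hi.ne']) hpos (Nat.pos_of_ne_zero hpos')
      have hlt : w (r + (Finsupp.single (i, j') 1 + Finsupp.single (i', j) 1)) <
          w (r + (Finsupp.single (i, j) 1 + Finsupp.single (i', j') 1)) := by
        simp only [map_add, w_single]
        obtain ⟨d, hd, hd'⟩ : ∃ d, (i : ℕ) = i' + d ∧ 0 < d := ⟨i - i', by omega, by omega⟩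
        obtain ⟨e, he, he'⟩ : ∃ e, n - (j : ℕ) = n - j' + e ∧ 0 < e := ⟨j' - j, by omega, by omega⟩
        rw [hd, he]
        nlinarith [Nat.mul_pos hd' he']
      obtain ⟨p', hp', hmargins, hmem⟩ := ih _ hlt _ rfl
      refine ⟨p', hp', hmargins.trans (margins_exchange r i i' j j'), ?_⟩
      have hexchange := monomial_exchange_sub_mem (k := k) r i i' j j'
      simpa using add_mem hexchange hmem

/-- A monomial having both a row sum and a column sum at least `q` is congruent, modulo the
`2 × 2` minors, to a multiple of `x ^ q` for some variable `x`. -/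
theorem monomial_mem_of_not_hasSmallMargin (p : Fin m × Fin n →₀ ℕ)
    (hp : ¬ HasSmallMargin q (margins p)) :
    monomial p 1 ∈ minorsIdeal m n k ⊔ powersIdeal m n q k := by
  simp only [HasSmallMargin, not_or, not_forall, not_lt] at hp
  obtain ⟨⟨i, hi⟩, j, hj⟩ := hp
  induction hN : q - p (i, j) using Nat.strong_induction_on generalizing p with
  | _ N ih =>
    subst hN
    by_cases hq : q ≤ p (i, j)
    · refine Ideal.mem_sup_right ?_
      have hle : Finsupp.single (i, j) q ≤ p := by simpa using hq
      rw [← tsub_add_cancel_of_le hle, ← one_mul (1 : k), ← monomial_mul, ← X_pow_eq_monomial]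
      exact Ideal.mul_mem_left _ _ (Ideal.subset_span ⟨(i, j), rfl⟩)
    · push Not at hq
      obtain ⟨j', hj', hpos'⟩ : ∃ j', j' ≠ j ∧ 0 < p (i, j') := by
        by_contra! h
        have hsum : ∑ c, p (i, c) = p (i, j) :=
          Finset.sum_eq_single j (fun c _ hc => Nat.le_zero.mp (h c hc)) (by simp)
        exact absurd (hi.trans_eq hsum) hq.not_ge
      obtain ⟨i', hi', hpos⟩ : ∃ i', i' ≠ i ∧ 0 < p (i', j) := by
        by_contra! h
        have hsum : ∑ c, p (c, j) = p (i, j) :=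
          Finset.sum_eq_single i (fun c _ hc => Nat.le_zero.mp (h c hc)) (by simp)
        exact absurd (hj.trans_eq hsum) hq.not_ge
      obtain ⟨r, rfl⟩ := exists_eq_add_single_add_single (a := (i, j')) (b := (i', j))
        (by simp [hj']) hpos' hpos
      have hmargins := margins_exchange r i i' j' j
      have hmem := ih _ ?_ (r + (Finsupp.single (i, j) 1 + Finsupp.single (i', j') 1))
        (by rwa [hmargins]) (by rwa [hmargins]) rfl
      · simpa using add_mem (Ideal.mem_sup_left (monomial_exchange_sub_mem (k := k) r i i' j' j))
          hmem
      · simp [hj', hi'] at hq ⊢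
        omega

open Classical in
/-- The linear map sending a monomial to the basis vector indexed by its row sums and column
sums if one of these is entirely below `q`, and to zero otherwise. -/
noncomputable def marginsMap (m n q : ℕ) (k : Type*) [Field k] :
    MvPolynomial (Fin m × Fin n) k →ₗ[k] ((Fin m → ℕ) × (Fin n → ℕ) →₀ k) :=
  (basisMonomials (Fin m × Fin n) k).constr k fun p =>
    if HasSmallMargin q (margins p) then Finsupp.single (margins p) 1 else 0

open Classical in
theorem marginsMap_monomial (p : Fin m × Fin n →₀ ℕ) :
    marginsMap m n q k (monomial p 1) =
      if HasSmallMargin q (margins p) then Finsupp.single (margins p) 1 else 0 := by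
  have h := (basisMonomials (Fin m × Fin n) k).constr_basis k (fun p =>
    if HasSmallMargin q (margins p) then Finsupp.single (margins p) (1 : k) else 0) p
  rwa [coe_basisMonomials] at h

theorem marginsMap_mul_eq_zero {f : MvPolynomial (Fin m × Fin n) k}
    (hf : ∀ p, marginsMap m n q k (monomial p 1 * f) = 0) (g : MvPolynomial (Fin m × Fin n) k) :
    marginsMap m n q k (g * f) = 0 := by
  induction g using MvPolynomial.induction_on' with
  | monomial p a =>
    rw [← mul_one a, ← smul_eq_mul a, ← smul_monomial, smul_mul_assoc, map_smul, hf, smul_zero]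
  | add g g' hg hg' => rw [add_mul, map_add, hg, hg', add_zero]

theorem marginsMap_eq_zero {f : MvPolynomial (Fin m × Fin n) k}
    (hf : f ∈ minorsIdeal m n k ⊔ powersIdeal m n q k) : marginsMap m n q k f = 0 := by
  suffices h : ∀ g, marginsMap m n q k (g * f) = 0 by simpa using h 1
  rw [minorsIdeal, powersIdeal, ← Ideal.span_union] at hf
  induction hf using Submodule.span_induction with
  | mem f hf =>
    refine marginsMap_mul_eq_zero fun p => ?_
    rcases hf with ⟨i, i', j, j', -, -, rfl⟩ | ⟨⟨i, j⟩, rfl⟩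
    · simp only [X, mul_sub, monomial_mul, mul_one, map_sub, marginsMap_monomial]
      rw [margins_exchange p i i' j j', sub_self]
    · rw [X_pow_eq_monomial, monomial_mul, one_mul, marginsMap_monomial, if_neg]
      simp only [HasSmallMargin, map_add, margins_single, not_or, not_forall, not_lt]
      exact ⟨⟨i, by simp⟩, j, by simp⟩
  | zero => simp
  | add f f' _ _ hf hf' => intro g; rw [mul_add, map_add, hf, hf', add_zero]
  | smul a f _ hf => intro g; rw [smul_eq_mul, ← mul_assoc, hf]

variable (m n q k) in
/-- The exponent matrices of the standard monomials. -/
def smallStaircases : Set (Fin m → Fin n → ℕ) :=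
  {p | IsStaircase p ∧ ((∀ i : Fin m, ∑ j, p i j < q) ∨ (∀ j : Fin n, ∑ i, p i j < q))}

/-- A matrix as an exponent vector. -/
noncomputable def exponent (p : Fin m → Fin n → ℕ) : Fin m × Fin n →₀ ℕ :=
  Finsupp.equivFunOnFinite.symm fun x => p x.1 x.2

/-- The class of the monomial with exponent matrix `p` modulo the `2 × 2` minors and the `q`-th
powers of the variables. -/
noncomputable def standardMonomial (p : smallStaircases m n q) :
    MvPolynomial (Fin m × Fin n) k ⧸ (minorsIdeal m n k ⊔ powersIdeal m n q k) :=
  Ideal.Quotient.mkₐ k _ (monomial (exponent p.1) 1)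

theorem linearIndependent_standardMonomial :
    LinearIndependent k (standardMonomial (m := m) (n := n) (q := q) (k := k)) := by
  have hinj : Function.Injective fun p : smallStaircases m n q => margins (exponent p.1) := by
    intro p p' h
    refine Subtype.ext (p.2.1.eq_of_sum_eq p'.2.1 (fun i => ?_) fun j => ?_)
    · exact congrFun (congrArg Prod.fst h) i
    · exact congrFun (congrArg Prod.snd h) j
  have hsingle : LinearIndependent k fun p : smallStaircases m n q =>
      marginsMap m n q k (monomial (exponent p.1) 1) := by
    have heq : (fun p : smallStaircases m n q =>
        marginsMap m n q k (monomial (exponent p.1) 1)) =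
          (fun s => Finsupp.single s (1 : k)) ∘ fun p => margins (exponent p.1) := by
      funext p
      rw [marginsMap_monomial, if_pos (show HasSmallMargin q (margins (exponent p.1)) from p.2.2)]
      rfl
    rw [heq]
    exact (Finsupp.linearIndependent_single_one k _).comp _ hinj
  rw [linearIndependent_iff] at hsingle ⊢
  intro l hl
  refine hsingle l ?_
  have hmk : Ideal.Quotient.mkₐ k (minorsIdeal m n k ⊔ powersIdeal m n q k)
      (Finsupp.linearCombination k
        (fun p : smallStaircases m n q => monomial (exponent p.1) (1 : k)) l) = 0 := by
    rw [← hl, ← AlgHom.toLinearMap_apply, Finsupp.apply_linearCombination]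
    rfl
  have hzero := marginsMap_eq_zero (Ideal.Quotient.eq_zero_iff_mem.mp hmk)
  rwa [Finsupp.apply_linearCombination] at hzero

theorem top_le_span_standardMonomial :
    ⊤ ≤ Submodule.span k (Set.range (standardMonomial (m := m) (n := n) (q := q) (k := k))) := by
  rintro x -
  obtain ⟨f, rfl⟩ := Ideal.Quotient.mkₐ_surjective k _ x
  induction f using MvPolynomial.induction_on' with
  | add f f' hf hf' => rw [map_add]; exact add_mem hf hf'
  | monomial p a =>
    rw [← mul_one a, ← smul_eq_mul a, ← smul_monomial, map_smul]
    refine Submodule.smul_mem _ _ ?_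
    by_cases hp : HasSmallMargin q (margins p)
    · obtain ⟨p', hp', hmargins, hmem⟩ := exists_isStaircase_monomial_sub_mem (k := k) p
      rw [← hmargins] at hp
      refine Submodule.subset_span ⟨⟨fun i j => p' (i, j), hp', hp⟩, ?_⟩
      have hexp : exponent (fun i j => p' (i, j)) = p' := by ext; rfl
      rw [standardMonomial, hexp]
      exact (Ideal.Quotient.eq.mpr (Ideal.mem_sup_left hmem)).symm
    · have hzero : Ideal.Quotient.mkₐ k (minorsIdeal m n k ⊔ powersIdeal m n q k)
          (monomial p 1) = 0 :=
        Ideal.Quotient.eq_zero_iff_mem.mpr (monomial_mem_of_not_hasSmallMargin p hp)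
      exact hzero ▸ zero_mem _

end ideal

theorem stmt_14 (k : Type*) [Field k] (m n q : ℕ) (hm : 0 < m) (hn : 0 < n) (hq : 0 < q)
    (I2 : Ideal (MvPolynomial (Fin m × Fin n) k))
    (hI2 : I2 = Ideal.span {f | ∃ (i i' : Fin m) (j j' : Fin n), i < i' ∧ j < j' ∧
      f = X (i, j) * X (i', j') - X (i, j') * X (i', j)})
    (J : Ideal (MvPolynomial (Fin m × Fin n) k))
    (hJ : J = Ideal.span {f | ∃ ij : Fin m × Fin n, f = X ij ^ q}) :
    Module.finrank k (MvPolynomial (Fin m × Fin n) k ⧸ (I2 + J))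
      = Set.ncard {p : Fin m → Fin n → ℕ | IsStaircase p ∧
          ((∀ i : Fin m, ∑ j, p i j < q) ∨ (∀ j : Fin n, ∑ i, p i j < q))} := by
  subst hI2 hJ
  exact Module.finrank_eq_nat_card_basis
    (Module.Basis.mk (linearIndependent_standardMonomial (m := m) (n := n) (q := q) (k := k))
      top_le_span_standardMonomial)
end
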